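/- Let X be a real symmetric n×n matrix and O_X := convexHull{g X gᵀ : g ∈ O(n)} its symmetric Schur–Horn orbitope. Then O_X has only finitely many O(n)-orbits of faces: there exists a finite collection 𝒮 of subsets of Mat_n(ℝ) such that every face of O_X (every convex extreme subset of O_X) is of the form {k Y kᵀ : Y ∈ F} for some F ∈ 𝒮 and some k ∈ O(n). -/

import Mathlib

open Matrix

section Convexity

variable {E : Type*} [AddCommGroup E] [Module ℝ E]

/-- If `F` is an extreme subset of a convex set `C`, then the points of `F` in the convex hull of
`S ⊆ C` lie in the convex hull of `S ∩ F`. -/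
theorem IsExtreme.mem_convexHull_inter {C F S : Set E} (hC : Convex ℝ C)
    (hF : IsExtreme ℝ C F) (hS : S ⊆ C) {x : E} (hxF : x ∈ F) (hx : x ∈ convexHull ℝ S) :
    x ∈ convexHull ℝ (S ∩ F) := by
  have hdiff : convexHull ℝ (S \ F) ⊆ C \ F :=
    convexHull_min (Set.sdiff_subset_sdiff_left hS) (hF.convex_sdiff hC)
  rw [← Set.inter_union_sdiff S F] at hx
  rcases (S ∩ F).eq_empty_or_nonempty with h₁ | h₁
  · rw [h₁, Set.empty_union] at hx
    exact absurd hxF (hdiff hx).2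
  rcases (S \ F).eq_empty_or_nonempty with h₂ | h₂
  · rwa [h₂, Set.union_empty] at hx
  rw [convexHull_union h₁ h₂, mem_convexJoin] at hx
  obtain ⟨a, ha, b, hb, hab⟩ := hx
  rw [← insert_endpoints_openSegment] at hab
  rcases hab with rfl | rfl | hab
  · exact ha
  · exact absurd hxF (hdiff hb).2
  · have haC : a ∈ C := convexHull_min (Set.inter_subset_left.trans hS) hC ha
    exact absurd (hF.right_mem_of_mem_openSegment haC (hdiff hb).1 hxF hab) (hdiff hb).2

/-- `x` is a relative interior point of `F`, in the algebraic sense: every segment in `F` ending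
at `x` can be prolonged beyond `x` inside `F`. -/
def IsAlgebraicRelInterior (F : Set E) (x : E) : Prop :=
  x ∈ F ∧ ∀ y ∈ F, ∃ z ∈ F, x ∈ openSegment ℝ y z

theorem IsAlgebraicRelInterior.subset_of_mem_isExtreme {C F G : Set E} {x : E}
    (hx : IsAlgebraicRelInterior F x) (hFC : F ⊆ C) (hG : IsExtreme ℝ C G) (hxG : x ∈ G) :
    F ⊆ G := by
  intro y hy
  obtain ⟨z, hz, hxyz⟩ := hx.2 y hy
  exact hG.left_mem_of_mem_openSegment (hFC hy) (hFC hz) hxG hxyz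

theorem IsAlgebraicRelInterior.image {E' : Type*} [AddCommGroup E'] [Module ℝ E']
    {F : Set E} {x : E} (hx : IsAlgebraicRelInterior F x) (φ : E →ₗ[ℝ] E') :
    IsAlgebraicRelInterior (φ '' F) (φ x) := by
  refine ⟨Set.mem_image_of_mem φ hx.1, ?_⟩
  rintro _ ⟨y, hy, rfl⟩
  obtain ⟨z, hz, hxyz⟩ := hx.2 y hy
  refine ⟨φ z, Set.mem_image_of_mem φ hz, ?_⟩
  rw [← LinearMap.coe_toAffineMap, ← image_openSegment]
  exact Set.mem_image_of_mem _ hxyz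

theorem IsExtreme.image_linearEquiv {E' : Type*} [AddCommGroup E'] [Module ℝ E']
    {C F : Set E} (hF : IsExtreme ℝ C F) (φ : E ≃ₗ[ℝ] E') :
    IsExtreme ℝ (φ '' C) (φ '' F) := by
  refine ⟨Set.image_mono hF.subset, ?_⟩
  rintro _ ⟨y, hy, rfl⟩ _ ⟨z, hz, rfl⟩ _ ⟨x, hx, rfl⟩ ⟨a, b, ha, hb, hab, h⟩
  refine Set.mem_image_of_mem φ (hF.left_mem_of_mem_openSegment hy hz hx ⟨a, b, ha, hb, hab, ?_⟩)
  exact φ.injective (by simpa using h)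

end Convexity

theorem Convex.exists_isAlgebraicRelInterior {E : Type*} [NormedAddCommGroup E] [NormedSpace ℝ E]
    [FiniteDimensional ℝ E] {F : Set E} (hF : Convex ℝ F) (hne : F.Nonempty) :
    ∃ x, IsAlgebraicRelInterior F x := by
  obtain ⟨x, hx⟩ := hne.intrinsicInterior hF
  refine ⟨x, intrinsicInterior_subset hx, fun y hy => ?_⟩
  obtain ⟨p, hp, rfl⟩ := mem_intrinsicInterior.1 hx
  have hyF : y ∈ affineSpan ℝ F := subset_affineSpan ℝ F hy
  let f : ℝ → affineSpan ℝ F :=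
    fun t => ⟨AffineMap.lineMap (p : E) y (-t), AffineMap.lineMap_mem _ p.2 hyF⟩
  have hf : Continuous f :=
    Continuous.subtype_mk (AffineMap.lineMap_continuous.comp continuous_neg) _
  have hf0 : f 0 = p := by ext; simp [f]
  have hev : ∀ᶠ t in nhds (0 : ℝ), ((f t : affineSpan ℝ F) : E) ∈ F := by
    have h := hf.continuousAt.preimage_mem_nhds
      (by rw [hf0]; exact mem_interior_iff_mem_nhds.1 hp)
    exact h
  obtain ⟨t, htF, ht⟩ :=
    ((hev.filter_mono nhdsWithin_le_nhds).and
      (self_mem_nhdsWithin : Set.Ioi (0 : ℝ) ∈ nhdsWithin 0 (Set.Ioi 0))).exists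
  have ht : 0 < t := ht
  refine ⟨f t, htF, t / (1 + t), 1 / (1 + t), by positivity, by positivity, by field_simp; ring, ?_⟩
  simp only [f, AffineMap.lineMap_apply_module]
  match_scalars <;> field_simp <;> ring

theorem Convex.exists_isAlgebraicRelInterior_matrix {m : Type*} [Fintype m]
    {F : Set (Matrix m m ℝ)} (hF : Convex ℝ F) (hne : F.Nonempty) :
    ∃ x, IsAlgebraicRelInterior F x := by
  let : NormedAddCommGroup (Matrix m m ℝ) := Matrix.normedAddCommGroup
  let : NormedSpace ℝ (Matrix m m ℝ) := Matrix.normedSpace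
  exact hF.exists_isAlgebraicRelInterior hne

namespace Matrix

variable {m : Type*} [Fintype m] [DecidableEq m]

/-- The orbit of `X` under conjugation by orthogonal matrices. -/
def schurHornOrbit (X : Matrix m m ℝ) : Set (Matrix m m ℝ) :=
  {M | ∃ g ∈ orthogonalGroup m ℝ, M = g * X * gᵀ}

/-- Conjugation by an orthogonal matrix as a linear equivalence. -/
def orthogonalConj (k : Matrix m m ℝ) (hk : k ∈ orthogonalGroup m ℝ) :
    Matrix m m ℝ ≃ₗ[ℝ] Matrix m m ℝ where
  toFun Y := k * Y * kᵀ
  invFun Y := kᵀ * Y * k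
  map_add' Y Z := by rw [mul_add, add_mul]
  map_smul' c Y := by simp
  left_inv Y := by
    have h := (mem_orthogonalGroup_iff' m ℝ).1 hk
    calc kᵀ * (k * Y * kᵀ) * k = (kᵀ * k) * Y * (kᵀ * k) := by simp only [Matrix.mul_assoc]
      _ = Y := by simp [h]
  right_inv Y := by
    have h := (mem_orthogonalGroup_iff m ℝ).1 hk
    calc k * (kᵀ * Y * k) * kᵀ = (k * kᵀ) * Y * (k * kᵀ) := by simp only [Matrix.mul_assoc]
      _ = Y := by simp [h]

theorem transpose_mem_orthogonalGroup {k : Matrix m m ℝ} (hk : k ∈ orthogonalGroup m ℝ) :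
    kᵀ ∈ orthogonalGroup m ℝ := by
  rw [mem_orthogonalGroup_iff, transpose_transpose]
  exact (mem_orthogonalGroup_iff' m ℝ).1 hk

theorem orthogonalConj_mem_schurHornOrbit {X M k : Matrix m m ℝ}
    (hk : k ∈ orthogonalGroup m ℝ) (hM : M ∈ schurHornOrbit X) :
    k * M * kᵀ ∈ schurHornOrbit X := by
  obtain ⟨g, hg, rfl⟩ := hM
  exact ⟨k * g, mul_mem hk hg, by simp only [transpose_mul, Matrix.mul_assoc]⟩

theorem schurHornOrbit_subset_of_mem {X Y : Matrix m m ℝ} (hY : Y ∈ schurHornOrbit X) :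
    schurHornOrbit Y ⊆ schurHornOrbit X := by
  rintro _ ⟨k, hk, rfl⟩
  exact orthogonalConj_mem_schurHornOrbit hk hY

theorem orthogonalConj_image_schurHornOrbit (X : Matrix m m ℝ) {k : Matrix m m ℝ}
    (hk : k ∈ orthogonalGroup m ℝ) :
    orthogonalConj k hk '' schurHornOrbit X = schurHornOrbit X := by
  refine subset_antisymm ?_ fun M hM => ⟨kᵀ * M * k, ?_, ?_⟩
  · rintro _ ⟨M, hM, rfl⟩
    exact orthogonalConj_mem_schurHornOrbit hk hM
  · simpa using orthogonalConj_mem_schurHornOrbit (transpose_mem_orthogonalGroup hk) hM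
  · exact (orthogonalConj k hk).apply_symm_apply M

theorem orthogonalConj_image_convexHull_schurHornOrbit (X : Matrix m m ℝ) {k : Matrix m m ℝ}
    (hk : k ∈ orthogonalGroup m ℝ) :
    orthogonalConj k hk '' convexHull ℝ (schurHornOrbit X) =
      convexHull ℝ (schurHornOrbit X) := by
  have h := (orthogonalConj k hk).toLinearMap.image_convexHull (schurHornOrbit X)
  rw [LinearEquiv.coe_coe, orthogonalConj_image_schurHornOrbit] at h
  exact h

theorem IsHermitian.exists_orthogonalGroup_eq_conj_diagonal {A : Matrix m m ℝ}
    (hA : A.IsHermitian) :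
    ∃ k ∈ orthogonalGroup m ℝ, ∃ d : m → ℝ, A = k * diagonal d * kᵀ :=
  ⟨hA.eigenvectorUnitary, hA.eigenvectorUnitary.2, hA.eigenvalues, hA.spectral_theorem⟩

theorem IsHermitian.exists_schurHornOrbit_eq_diagonal {A : Matrix m m ℝ} (hA : A.IsHermitian) :
    ∃ d : m → ℝ, schurHornOrbit A = schurHornOrbit (diagonal d) := by
  obtain ⟨k, hk, d, hd⟩ := hA.exists_orthogonalGroup_eq_conj_diagonal
  refine ⟨d, subset_antisymm (schurHornOrbit_subset_of_mem ⟨k, hk, hd⟩)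
    (schurHornOrbit_subset_of_mem ⟨kᵀ, transpose_mem_orthogonalGroup hk, ?_⟩)⟩
  rw [hd, transpose_transpose]
  exact ((orthogonalConj k hk).symm_apply_apply (diagonal d)).symm

theorem isHermitian_of_mem_convexHull_schurHornOrbit {X M : Matrix m m ℝ} (hX : X.IsHermitian)
    (hM : M ∈ convexHull ℝ (schurHornOrbit X)) : M.IsHermitian := by
  have hconv : Convex ℝ {A : Matrix m m ℝ | A.IsHermitian} := by
    intro A hA B hB a b _ _ _
    exact (hA.smul (IsSelfAdjoint.all a)).add (hB.smul (IsSelfAdjoint.all b))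
  refine convexHull_min ?_ hconv hM
  rintro _ ⟨g, -, rfl⟩
  exact isHermitian_mul_mul_conjTranspose g hX

theorem sq_entries_mem_doublyStochastic {g : Matrix m m ℝ} (hg : g ∈ orthogonalGroup m ℝ) :
    (of fun i j => g i j ^ 2) ∈ doublyStochastic ℝ m := by
  rw [mem_doublyStochastic_iff_sum]
  refine ⟨fun i j => sq_nonneg _, fun i => ?_, fun j => ?_⟩
  · have h := congrFun₂ ((mem_orthogonalGroup_iff m ℝ).1 hg) i i
    simpa [mul_apply, sq] using h
  · have h := congrFun₂ ((mem_orthogonalGroup_iff' m ℝ).1 hg) j j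
    simpa [mul_apply, sq] using h

theorem diag_conj_diagonal (g : Matrix m m ℝ) (d : m → ℝ) :
    (g * diagonal d * gᵀ).diag = (of fun i j => g i j ^ 2) *ᵥ d := by
  ext i
  rw [diag_apply, mul_apply]
  simp only [mul_diagonal, transpose_apply, mulVec, dotProduct, of_apply]
  exact Finset.sum_congr rfl fun j _ => by ring

/-- The diagonal matrices whose diagonal is a permutation of `d`. -/
def permutedDiagonals (d : m → ℝ) : Set (Matrix m m ℝ) :=
  Set.range fun σ : Equiv.Perm m => diagonal (d ∘ σ)

theorem permutedDiagonals_subset_schurHornOrbit (d : m → ℝ) :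
    permutedDiagonals d ⊆ schurHornOrbit (diagonal d) := by
  rintro _ ⟨σ, rfl⟩
  refine ⟨σ.permMatrix ℝ, ?_, ?_⟩
  · rw [mem_orthogonalGroup_iff, transpose_permMatrix, ← permMatrix_mul]
    simp
  · ext i j
    by_cases hij : i = j <;>
      simp [hij, mul_apply, PEquiv.toMatrix_apply, diagonal_apply, Equiv.symm_apply_eq]

/-- Schur's half of the Schur–Horn theorem. -/
theorem diagonal_diag_mem_convexHull_permutedDiagonals {d : m → ℝ} {M : Matrix m m ℝ}
    (hM : M ∈ convexHull ℝ (schurHornOrbit (diagonal d))) :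
    diagonal M.diag ∈ convexHull ℝ (permutedDiagonals d) := by
  let D : Matrix m m ℝ →ₗ[ℝ] Matrix m m ℝ :=
    diagonalLinearMap m ℝ ℝ ∘ₗ diagLinearMap m ℝ ℝ
  refine convexHull_min (t := D ⁻¹' convexHull ℝ (permutedDiagonals d)) ?_
    ((convex_convexHull ℝ _).linear_preimage D) hM
  rintro _ ⟨g, hg, rfl⟩
  let L : Matrix m m ℝ →ₗ[ℝ] Matrix m m ℝ :=
    diagonalLinearMap m ℝ ℝ ∘ₗ (mulVecBilin ℝ ℝ).flip d
  have hL : ∀ A, L A = diagonal (A *ᵥ d) := fun A => rfl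
  have hmem := sq_entries_mem_doublyStochastic hg
  rw [← SetLike.mem_coe, doublyStochastic_eq_convexHull_permMatrix] at hmem
  have himage := Set.mem_image_of_mem L hmem
  rw [L.image_convexHull, hL, ← diag_conj_diagonal] at himage
  refine convexHull_mono ?_ himage
  rintro _ ⟨_, ⟨σ, rfl⟩, rfl⟩
  exact ⟨σ, by rw [hL, permMatrix_mulVec]⟩

/-- The faces of the Schur–Horn orbitope of `diagonal d` that have a diagonal matrix in their
relative interior. -/
def diagonalFaces (d : m → ℝ) : Set (Set (Matrix m m ℝ)) :=
  {F | IsExtreme ℝ (convexHull ℝ (schurHornOrbit (diagonal d))) F ∧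
    ∃ e : m → ℝ, IsAlgebraicRelInterior F (diagonal e)}

theorem subset_of_mem_diagonalFaces {d : m → ℝ} {F G : Set (Matrix m m ℝ)}
    (hF : F ∈ diagonalFaces d) (hG : G ∈ diagonalFaces d) (hGconv : Convex ℝ G)
    (h : permutedDiagonals d ∩ F ⊆ G) : F ⊆ G := by
  obtain ⟨hFext, e, he⟩ := hF
  refine he.subset_of_mem_isExtreme hFext.subset hG.1 ?_
  have hperm : permutedDiagonals d ⊆ convexHull ℝ (schurHornOrbit (diagonal d)) :=
    (permutedDiagonals_subset_schurHornOrbit d).trans (subset_convexHull ℝ _)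
  have hmem := diagonal_diag_mem_convexHull_permutedDiagonals (hFext.subset he.1)
  rw [diag_diagonal] at hmem
  exact convexHull_min h hGconv
    (hFext.mem_convexHull_inter (convex_convexHull ℝ _) hperm he.1 hmem)

theorem finite_diagonalFaces (d : m → ℝ) : {F ∈ diagonalFaces d | Convex ℝ F}.Finite := by
  have hfin : (𝒫 permutedDiagonals d).Finite := (Set.finite_range _).finite_subsets
  refine Set.Finite.of_finite_image
    (hfin.subset (Set.image_subset_iff.2 fun F _ => Set.inter_subset_left))
    (f := fun F => permutedDiagonals d ∩ F) ?_
  intro F hF G hG hFG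
  have hFG : permutedDiagonals d ∩ F = permutedDiagonals d ∩ G := hFG
  exact subset_antisymm
    (subset_of_mem_diagonalFaces hF.1 hG.1 hG.2 (hFG.trans_subset Set.inter_subset_right))
    (subset_of_mem_diagonalFaces hG.1 hF.1 hF.2 (hFG.symm.trans_subset Set.inter_subset_right))

theorem exists_mem_diagonalFaces_eq_image {d : m → ℝ} {F : Set (Matrix m m ℝ)}
    (hconv : Convex ℝ F) (hF : IsExtreme ℝ (convexHull ℝ (schurHornOrbit (diagonal d))) F)
    (hne : F.Nonempty) :
    ∃ G ∈ {F ∈ diagonalFaces d | Convex ℝ F}, ∃ k ∈ orthogonalGroup m ℝ,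
      F = (fun Y => k * Y * kᵀ) '' G := by
  obtain ⟨x, hx⟩ := hconv.exists_isAlgebraicRelInterior_matrix hne
  obtain ⟨k, hk, e, rfl⟩ := (isHermitian_of_mem_convexHull_schurHornOrbit
    (isHermitian_diagonal d) (hF.subset hx.1)).exists_orthogonalGroup_eq_conj_diagonal
  let φ := orthogonalConj k hk
  have hC : φ.symm '' convexHull ℝ (schurHornOrbit (diagonal d)) =
      convexHull ℝ (schurHornOrbit (diagonal d)) := by
    rw [LinearEquiv.image_symm_eq_preimage, Set.preimage_eq_iff_eq_image φ.bijective]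
    exact (orthogonalConj_image_convexHull_schurHornOrbit _ hk).symm
  refine ⟨φ.symm '' F, ⟨⟨hC ▸ hF.image_linearEquiv φ.symm, e, ?_⟩,
    hconv.linear_image φ.symm.toLinearMap⟩, k, hk, ?_⟩
  · have h := hx.image φ.symm.toLinearMap
    rw [LinearEquiv.coe_coe] at h
    exact (φ.symm_apply_apply (diagonal e)) ▸ h
  · change F = φ '' (φ.symm '' F)
    rw [Set.image_image]
    simp

end Matrix

/-- the symmetric Schur–Horn orbitope `O_X = convexHull {g X gᵀ : g ∈ O(n)}`
(for `X` real symmetric) has only finitely many `O(n)`-orbits of faces: there is a finite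
collection `𝒮` of subsets of `Mat_n(ℝ)` such that every face of `O_X` is of the form
`{k Y kᵀ : Y ∈ G}` for some `G ∈ 𝒮` and some `k ∈ O(n)`. -/
theorem schurHorn_orbitope_finitely_many_face_orbits
    {n : ℕ} (X : Matrix (Fin n) (Fin n) ℝ) (hX : X.IsHermitian) :
    ∃ 𝒮 : Set (Set (Matrix (Fin n) (Fin n) ℝ)), 𝒮.Finite ∧
      ∀ F : Set (Matrix (Fin n) (Fin n) ℝ), Convex ℝ F →
        IsExtreme ℝ (convexHull ℝ {m : Matrix (Fin n) (Fin n) ℝ |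
            ∃ g ∈ Matrix.orthogonalGroup (Fin n) ℝ, m = g * X * gᵀ}) F →
          ∃ G ∈ 𝒮, ∃ k ∈ Matrix.orthogonalGroup (Fin n) ℝ,
            F = (fun Y => k * Y * kᵀ) '' G := by
  obtain ⟨d, hd⟩ := hX.exists_schurHornOrbit_eq_diagonal
  refine ⟨insert ∅ {F ∈ diagonalFaces d | Convex ℝ F}, (finite_diagonalFaces d).insert ∅, ?_⟩
  intro F hconv hF
  change IsExtreme ℝ (convexHull ℝ (schurHornOrbit X)) F at hF
  rw [hd] at hF
  rcases F.eq_empty_or_nonempty with rfl | hne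
  · exact ⟨∅, Set.mem_insert _ _, 1, one_mem _, (Set.image_empty _).symm⟩
  · obtain ⟨G, hG, h⟩ := exists_mem_diagonalFaces_eq_image hconv hF hne
    exact ⟨G, Set.mem_insert_of_mem _ hG, h⟩
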